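/- Let n ≥ 1 and let φ : ℝⁿ → ℝⁿ be a smooth diffeomorphism with smooth inverse and everywhere invertible derivative Dφ; write ℓ_φ = log|det Dφ|. Let S^{ij}, S̄^{ab} : ℝⁿ → ℝ be smooth and symmetric in their indices, related by the tensor law S̄^{ab}(φ(x)) = ∑_{i,j} ∂_i φ^a(x) ∂_j φ^b(x) S^{ij}(x). Let Π^k_{ij}, Π̄^c_{ab} : ℝⁿ → ℝ be smooth, symmetric in the lower indices, related by the projective-class transformation law Π^k_{ij}(x) = ∑_{a,b,c} ∂_i φ^a(x) ∂_j φ^b(x) Π̄^c_{ab}(φ(x)) [(Dφ(x))^{-1}]^k_c + 𝔖(φ)^k_{ij}(x), where 𝔖(φ)^k_{ij} = ∑_σ ∂_i∂_j φ^σ (Dφ)^{-1}{}^k_σ − (1/(n+1))(δ^k_i ∂_j ℓ_φ + δ^k_j ∂_i ℓ_φ). Define the projective Laplacian L_{S,Π} u := ∑_{i,j} S^{ij} ∂_i∂_j u + ∑_i ( (2/(n+3)) ∑_j ∂_j S^{ij} − ((n+1)/(n+3)) ∑_{j,k} S^{jk} Π^i_{jk} ) ∂_i u, and similarly L_{S̄,Π̄}.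 Then for every smooth u : ℝⁿ → ℝ and every x ∈ ℝⁿ, writing ū := u ∘ φ^{-1}, one has (L_{S̄,Π̄} ū)(φ(x)) = (L_{S,Π} u)(x). -/

import Mathlib

/-- Partial derivative `∂ᵢ g (x)` of a scalar function on `ℝⁿ`. -/
noncomputable def pd {n : ℕ} (g : (Fin n → ℝ) → ℝ) (i : Fin n) (x : Fin n → ℝ) : ℝ :=
  fderiv ℝ g x (Pi.single i 1)

/-- Jacobian matrix `(Df(x))^σ_i = ∂ᵢ f^σ (x)`. -/
noncomputable def jac {n : ℕ} (f : (Fin n → ℝ) → Fin n → ℝ) (x : Fin n → ℝ) :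
    Matrix (Fin n) (Fin n) ℝ :=
  fun σ i => pd (fun y => f y σ) i x

/-- `ℓ_f = log |det Df|`. -/
noncomputable def logJ {n : ℕ} (f : (Fin n → ℝ) → Fin n → ℝ) (x : Fin n → ℝ) : ℝ :=
  Real.log |(jac f x).det|

/-- Kronecker delta. -/
noncomputable def kdelta {n : ℕ} (i j : Fin n) : ℝ := if i = j then 1 else 0

/-- The multidimensional Schwarzian derivative
`𝔖(f)^k_{ij} = ∂ᵢ∂ⱼf^σ·[(Df)⁻¹]^k_σ − (1/(n+1))(δ^k_i ∂ⱼℓ_f + δ^k_j ∂ᵢℓ_f)`. -/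
noncomputable def schw {n : ℕ} (f : (Fin n → ℝ) → Fin n → ℝ) (x : Fin n → ℝ)
    (k i j : Fin n) : ℝ :=
  (∑ σ, pd (fun y => pd (fun z => f z σ) j y) i x * (jac f x)⁻¹ k σ)
    - (1 / ((n : ℝ) + 1)) *
      (kdelta k i * pd (logJ f) j x + kdelta k j * pd (logJ f) i x)

/-- The projective Laplacian
`L u = ∑ S^{ij}∂ᵢ∂ⱼu + ∑ᵢ((2/(n+3))∑ⱼ∂ⱼS^{ij} − ((n+1)/(n+3))∑_{j,k}S^{jk}Π^i_{jk})∂ᵢu`,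
where `P k i j` stands for `Π^k_{ij}`. -/
noncomputable def projLap {n : ℕ} (S : Fin n → Fin n → (Fin n → ℝ) → ℝ)
    (P : Fin n → Fin n → Fin n → (Fin n → ℝ) → ℝ)
    (u : (Fin n → ℝ) → ℝ) (x : Fin n → ℝ) : ℝ :=
  (∑ i, ∑ j, S i j x * pd (fun y => pd u j y) i x) +
    ∑ i, ((2 / ((n : ℝ) + 3)) * (∑ j, pd (fun y => S i j y) j x)
        - (((n : ℝ) + 1) / ((n : ℝ) + 3)) * ∑ j, ∑ k, S j k x * P i j k x) * pd u i x

section Calculus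

variable {n : ℕ} {f g : (Fin n → ℝ) → ℝ} {x : Fin n → ℝ}

theorem contDiff_pd (hf : ContDiff ℝ (⊤ : ℕ∞) f) (i : Fin n) :
    ContDiff ℝ (⊤ : ℕ∞) (fun y => pd f i y) :=
  (hf.fderiv_right (m := ((⊤ : ℕ∞) : WithTop ℕ∞)) (by simp)).clm_apply contDiff_const

theorem pd_mul (hf : DifferentiableAt ℝ f x) (hg : DifferentiableAt ℝ g x) (i : Fin n) :
    pd (fun y => f y * g y) i x = pd f i x * g x + f x * pd g i x := by
  simp only [pd, fderiv_fun_mul hf hg, add_apply, smul_apply, smul_eq_mul]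
  ring

theorem pd_sum {ι : Type*} (s : Finset ι) {F : ι → (Fin n → ℝ) → ℝ}
    (hF : ∀ a ∈ s, DifferentiableAt ℝ (F a) x) (i : Fin n) :
    pd (fun y => ∑ a ∈ s, F a y) i x = ∑ a ∈ s, pd (F a) i x := by
  simp only [pd, fderiv_fun_sum hF, sum_apply]

/-- The directional derivative in terms of the partial derivatives. -/
theorem fderiv_apply_eq_sum_pd (f : (Fin n → ℝ) → ℝ) (x v : Fin n → ℝ) :
    fderiv ℝ f x v = ∑ a, v a * pd f a x := by
  conv_lhs => rw [pi_eq_sum_univ' v]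
  simp [pd, map_sum]

theorem pd_comp {φ : (Fin n → ℝ) → Fin n → ℝ} (hf : DifferentiableAt ℝ f (φ x))
    (hφ : DifferentiableAt ℝ φ x) (i : Fin n) :
    pd (fun y => f (φ y)) i x = ∑ a, pd (fun y => φ y a) i x * pd f a (φ x) := by
  have h : fderiv ℝ (fun y => f (φ y)) x = (fderiv ℝ f (φ x)).comp (fderiv ℝ φ x) :=
    fderiv_comp x hf hφ
  have hc : ∀ a, pd (fun y => φ y a) i x = fderiv ℝ φ x (Pi.single i 1) a := fun a => by
    simp only [pd, fderiv_apply hφ a]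
    rfl
  simp only [hc, ← fderiv_apply_eq_sum_pd]
  simp [pd, h]

theorem pd_pd_comm (hf : ContDiff ℝ (⊤ : ℕ∞) f) (i j : Fin n) :
    pd (fun y => pd f j y) i x = pd (fun y => pd f i y) j x := by
  have hf2 : ContDiff ℝ 2 f := by exact_mod_cast contDiff_infty.1 hf 2
  have hd : DifferentiableAt ℝ (fderiv ℝ f) x :=
    ((hf2.fderiv_right (m := 1) (by norm_num)).differentiable one_ne_zero) x
  have h : ∀ k l, pd (fun y => pd f l y) k x
      = fderiv ℝ (fderiv ℝ f) x (Pi.single k 1) (Pi.single l 1) := fun k l => by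
    have : fderiv ℝ (fun y => fderiv ℝ f y (Pi.single l 1)) x = _ :=
      fderiv_clm_apply hd (differentiableAt_const _)
    simp only [pd, this]
    simp
  rw [h, h]
  exact (hf2.contDiffAt.isSymmSndFDerivAt (by simp)) _ _

/-- Jacobi's formula for the derivative of the determinant of a matrix of functions. -/
theorem pd_det {A : (Fin n → ℝ) → Matrix (Fin n) (Fin n) ℝ}
    (hA : ∀ a i, DifferentiableAt ℝ (fun y => A y a i) x) (k : Fin n) :
    DifferentiableAt ℝ (fun y => (A y).det) x ∧
      pd (fun y => (A y).det) k x
        = ∑ a, ∑ i, (A x).adjugate i a * pd (fun y => A y a i) k x := by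
  let D : ContinuousMultilinearMap ℝ (fun _ : Fin n => Fin n → ℝ) ℝ :=
    ⟨(Matrix.detRowAlternating (n := Fin n) (R := ℝ)).toMultilinearMap, by
      exact Continuous.matrix_det continuous_id⟩
  let B : (Fin n → ℝ) → Fin n → Fin n → ℝ := fun y => A y
  have hB : DifferentiableAt ℝ B x :=
    differentiableAt_pi.2 fun a => differentiableAt_pi.2 fun i => hA a i
  have h : HasFDerivAt (fun y => (A y).det) ((D.linearDeriv (B x)).comp (fderiv ℝ B x)) x :=
    (D.hasFDerivAt (B x)).comp x hB.hasFDerivAt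
  refine ⟨h.differentiableAt, ?_⟩
  have hc : ∀ a i, pd (fun y => A y a i) k x = fderiv ℝ B x (Pi.single k 1) a i := fun a i => by
    have h1 := hasFDerivAt_pi'.1 (hasFDerivAt_pi'.1 hB.hasFDerivAt a) i
    have h2 : fderiv ℝ (fun y => A y a i) x = _ := h1.fderiv
    simp only [pd, h2]
    rfl
  simp only [hc]
  simp only [pd, h.fderiv, ContinuousLinearMap.comp_apply,
    ContinuousMultilinearMap.linearDeriv_apply]
  refine Finset.sum_congr rfl fun a _ => ?_
  have h3 : D (Function.update (B x) a (fderiv ℝ B x (Pi.single k 1) a))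
      = ((A x).updateRow a (fderiv ℝ B x (Pi.single k 1) a)).det := rfl
  rw [h3, ← Matrix.cramer_transpose_apply, Matrix.cramer_eq_adjugate_mulVec,
    ← Matrix.adjugate_transpose]
  rfl

theorem pd_logJ {φ : (Fin n → ℝ) → Fin n → ℝ} (hφ : ContDiff ℝ (⊤ : ℕ∞) φ)
    (hD : IsUnit (jac φ x).det) (k : Fin n) :
    pd (logJ φ) k x
      = ∑ a, ∑ i, (jac φ x)⁻¹ i a * pd (fun y => pd (fun z => φ z a) i y) k x := by
  have hJ : ∀ a i, DifferentiableAt ℝ (fun y => jac φ y a i) x := fun a i =>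
    (contDiff_pd (contDiff_pi.1 hφ a) i).differentiable (by simp) x
  obtain ⟨hd, hpd⟩ := pd_det hJ k
  have hl : logJ φ = fun y => Real.log (jac φ y).det := funext fun y => Real.log_abs _
  have h : pd (logJ φ) k x = ((jac φ x).det)⁻¹ * pd (fun y => (jac φ y).det) k x := by
    simp only [hl, pd, fderiv.log hd hD.ne_zero, smul_apply, smul_eq_mul]
  simp only [h, hpd, Finset.mul_sum, Matrix.inv_def, Ring.inverse_eq_inv', Matrix.smul_apply,
    smul_eq_mul, mul_assoc]
  rfl

end Calculus

section Contraction

variable {n : ℕ} {J K : Matrix (Fin n) (Fin n) ℝ}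

theorem sum_mul_sum_of_mul_eq_one (hJK : J * K = 1) (X : Fin n → ℝ) (a : Fin n) :
    ∑ i, J a i * ∑ c, K i c * X c = X a := by
  change (J.mulVec (K.mulVec X)) a = X a
  simp [Matrix.mulVec_mulVec, hJK]

theorem sum_sum_mul_sum_of_mul_eq_one (hKJ : K * J = 1) (G : Fin n → Fin n → ℝ) :
    ∑ b, ∑ k, K k b * ∑ j, J b j * G k j = ∑ k, G k k := by
  rw [Finset.sum_comm]
  exact Finset.sum_congr rfl fun k _ => sum_mul_sum_of_mul_eq_one hKJ (G k) k

/-- The divergence of a pushed-forward contravariant 2-tensor: `H` holds the second derivatives of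
the diffeomorphism, `dS i j k` stands for `∂ₖS^{ij}`, and `T a b c` for the derivatives of the
pushed-forward tensor. -/
theorem divergence_transform (hKJ : K * J = 1) {H : Fin n → Fin n → Fin n → ℝ}
    (hH : ∀ a i j, H a i j = H a j i) {S : Fin n → Fin n → ℝ}
    {dS T : Fin n → Fin n → Fin n → ℝ}
    (hT : ∀ a b k, ∑ c, J c k * T a b c = ∑ i, ∑ j,
      ((H a k i * J b j + J a i * H b k j) * S i j + J a i * J b j * dS i j k)) (a : Fin n) :
    ∑ b, T a b b = (∑ i, ∑ j, S i j * H a i j)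
      + (∑ i, J a i * ∑ j, S i j * ∑ b, ∑ k, K k b * H b j k) + ∑ i, J a i * ∑ j, dS i j j := by
  have hT' : ∀ b, T a b b = ∑ k, K k b * ∑ c, J c k * T a b c := fun b => by
    have h : J.transpose * K.transpose = 1 ∧ K.transpose * J.transpose = 1 := by
      rw [← Matrix.transpose_mul, ← Matrix.transpose_mul, hKJ, mul_eq_one_comm.1 hKJ]
      simp
    exact (sum_mul_sum_of_mul_eq_one h.2 (T a b) b).symm
  have e : ∀ b k, (∑ i, ∑ j,
      ((H a k i * J b j + J a i * H b k j) * S i j + J a i * J b j * dS i j k))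
      = (∑ j, J b j * ∑ i, H a k i * S i j) + (∑ i, ∑ j, J a i * H b k j * S i j)
        + ∑ j, J b j * ∑ i, J a i * dS i j k := fun b k => by
    simp only [Finset.mul_sum, add_mul, Finset.sum_add_distrib]
    congr 1
    · congr 1
      rw [Finset.sum_comm]
      refine Finset.sum_congr rfl fun _ _ => Finset.sum_congr rfl fun _ _ => by ring
    · rw [Finset.sum_comm]
      refine Finset.sum_congr rfl fun _ _ => Finset.sum_congr rfl fun _ _ => by ring
  simp only [hT', hT, e]
  simp only [mul_add, Finset.sum_add_distrib, sum_sum_mul_sum_of_mul_eq_one hKJ]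
  congr 1
  · congr 1
    · rw [Finset.sum_comm]
      refine Finset.sum_congr rfl fun i _ => Finset.sum_congr rfl fun j _ => ?_
      rw [hH a j i, mul_comm]
    · simp only [Finset.mul_sum]
      have : ∀ F : Fin n → Fin n → Fin n → Fin n → ℝ,
          ∑ b, ∑ k, ∑ i, ∑ j, F b k i j = ∑ i, ∑ j, ∑ b, ∑ k, F b k i j := fun F => by
        simp only [← Finset.sum_product', Finset.univ_product_univ]
        refine Fintype.sum_equiv ⟨fun p => (p.2.2.1, p.2.2.2, p.1, p.2.1),
          fun p => (p.2.2.1, p.2.2.2, p.1, p.2.1), fun _ => rfl, fun _ => rfl⟩ _ _ fun _ => rfl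
      rw [this]
      refine Finset.sum_congr rfl fun i _ => Finset.sum_congr rfl fun j _ =>
        Finset.sum_congr rfl fun b _ => Finset.sum_congr rfl fun k _ => ?_
      rw [hH b j k]
      ring
  · rw [Finset.sum_comm]
    simp only [Finset.mul_sum]

/-- The trace of the projective class against a symmetric tensor, under the Schwarzian-corrected
transformation law. -/
theorem trace_projective_transform (hJK : J * K = 1) {H P Q : Fin n → Fin n → Fin n → ℝ}
    {S T : Fin n → Fin n → ℝ} (hS : ∀ i j, S i j = S j i) (r : ℝ) (l : Fin n → ℝ)
    (hT : ∀ a b, T a b = ∑ i, ∑ j, J a i * J b j * S i j)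
    (hP : ∀ k i j, P k i j = (∑ a, ∑ b, ∑ c, J a i * J b j * Q c a b * K k c)
      + ((∑ σ, H σ i j * K k σ) - r * (kdelta k i * l j + kdelta k j * l i))) (a : Fin n) :
    ∑ i, J a i * ∑ j, ∑ k, S j k * P i j k = (∑ b, ∑ c, T b c * Q a b c)
      + (∑ i, ∑ j, S i j * H a i j) - 2 * r * ∑ i, J a i * ∑ j, S i j * l j := by
  have e : ∀ j k, ∑ i, J a i * P i j k = (∑ b, ∑ c, J b j * J c k * Q a b c)
      + H a j k - r * (J a j * l k + J a k * l j) := fun j k => by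
    have h1 : ∀ i, P i j k = (∑ c, K i c * ((∑ b, ∑ d, J b j * J d k * Q c b d) + H c j k))
        - r * (kdelta i j * l k + kdelta i k * l j) := fun i => by
      rw [hP, ← add_sub_assoc]
      congr 1
      simp only [mul_add, Finset.sum_add_distrib, Finset.mul_sum]
      congr 1
      · rw [Finset.sum_comm_cycle]
        refine Finset.sum_congr rfl fun _ _ => Finset.sum_congr rfl fun _ _ =>
          Finset.sum_congr rfl fun _ _ => by ring
      · exact Finset.sum_congr rfl fun _ _ => mul_comm _ _
    simp only [h1, mul_sub, Finset.sum_sub_distrib, sum_mul_sum_of_mul_eq_one hJK]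
    congr 1
    simp [kdelta, mul_add, Finset.sum_add_distrib]
    ring
  have h2 : ∑ i, J a i * ∑ j, ∑ k, S j k * P i j k = ∑ j, ∑ k, S j k * ∑ i, J a i * P i j k := by
    simp only [Finset.mul_sum]
    rw [← Finset.sum_comm_cycle]
    refine Finset.sum_congr rfl fun _ _ => Finset.sum_congr rfl fun _ _ =>
      Finset.sum_congr rfl fun _ _ => by ring
  have h3 : ∑ j, ∑ k, S j k * ∑ b, ∑ c, J b j * J c k * Q a b c
      = ∑ b, ∑ c, T b c * Q a b c := by
    simp only [hT, Finset.mul_sum, Finset.sum_mul]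
    simp only [← Finset.sum_product', Finset.univ_product_univ]
    refine Fintype.sum_equiv ⟨fun p => (p.2.2.1, p.2.2.2, p.1, p.2.1),
      fun p => (p.2.2.1, p.2.2.2, p.1, p.2.1), fun _ => rfl, fun _ => rfl⟩ _ _ fun p => ?_
    simp only [Equiv.coe_fn_mk]
    ring
  have h4 : ∑ j, ∑ k, S j k * (r * (J a j * l k + J a k * l j))
      = 2 * r * ∑ i, J a i * ∑ j, S i j * l j := by
    have h5 : ∑ j, ∑ k, S j k * (J a k * l j) = ∑ i, J a i * ∑ j, S i j * l j := by
      rw [Finset.sum_comm]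
      simp only [Finset.mul_sum]
      refine Finset.sum_congr rfl fun i _ => Finset.sum_congr rfl fun j _ => ?_
      rw [hS j i]
      ring
    have h6 : ∑ j, ∑ k, S j k * (J a j * l k) = ∑ i, J a i * ∑ j, S i j * l j := by
      simp only [Finset.mul_sum]
      refine Finset.sum_congr rfl fun i _ => Finset.sum_congr rfl fun j _ => by ring
    simp only [mul_left_comm _ r, ← Finset.mul_sum, mul_add, Finset.sum_add_distrib, h5, h6]
    ring
  simp only [h2, e, mul_sub, mul_add (S _ _), Finset.sum_sub_distrib, Finset.sum_add_distrib,
    h3, h4]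

end Contraction

/-- Invariance of the projective Laplacian: if `S` transforms as a
symmetric contravariant 2-tensor and `Π` transforms with the Schwarzian cocycle
correction under a diffeomorphism `φ`, then `(L_{S̄,Π̄}(u∘φ⁻¹))(φ(x)) = (L_{S,Π}u)(x)`. -/
theorem projective_laplacian_invariance {n : ℕ} (hn : 1 ≤ n)
    (φ φinv : (Fin n → ℝ) → Fin n → ℝ)
    (hφ : ContDiff ℝ (⊤ : ℕ∞) φ) (hφinv : ContDiff ℝ (⊤ : ℕ∞) φinv)
    (hleft : Function.LeftInverse φinv φ) (hright : Function.RightInverse φinv φ)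
    (hD : ∀ x, IsUnit (jac φ x).det)
    (S Sb : Fin n → Fin n → (Fin n → ℝ) → ℝ)
    (hS : ∀ i j, ContDiff ℝ (⊤ : ℕ∞) (S i j)) (hSb : ∀ a b, ContDiff ℝ (⊤ : ℕ∞) (Sb a b))
    (hSsym : ∀ i j, S i j = S j i) (hSbsym : ∀ a b, Sb a b = Sb b a)
    (hStrans : ∀ a b x, Sb a b (φ x) =
      ∑ i, ∑ j, pd (fun y => φ y a) i x * pd (fun y => φ y b) j x * S i j x)
    (P Pb : Fin n → Fin n → Fin n → (Fin n → ℝ) → ℝ)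
    (hP : ∀ k i j, ContDiff ℝ (⊤ : ℕ∞) (P k i j)) (hPb : ∀ c a b, ContDiff ℝ (⊤ : ℕ∞) (Pb c a b))
    (hPsym : ∀ k i j, P k i j = P k j i) (hPbsym : ∀ c a b, Pb c a b = Pb c b a)
    (hPtrans : ∀ k i j x, P k i j x =
      (∑ a, ∑ b, ∑ c, pd (fun y => φ y a) i x * pd (fun y => φ y b) j x *
          Pb c a b (φ x) * (jac φ x)⁻¹ k c) + schw φ x k i j)
    (u : (Fin n → ℝ) → ℝ) (hu : ContDiff ℝ (⊤ : ℕ∞) u) (x : Fin n → ℝ) :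
    projLap Sb Pb (fun z => u (φinv z)) (φ x) = projLap S P u x := by
  set v : (Fin n → ℝ) → ℝ := fun z => u (φinv z) with hv
  have hvs : ContDiff ℝ (⊤ : ℕ∞) v := hu.comp hφinv
  have huv : u = fun y => v (φ y) := funext fun y => by simp [hv, hleft y]
  have diff : ∀ {g : (Fin n → ℝ) → ℝ}, ContDiff ℝ (⊤ : ℕ∞) g → ∀ z, DifferentiableAt ℝ g z :=
    fun hg z => hg.differentiable (by simp) z
  have hφa : ∀ a, ContDiff ℝ (⊤ : ℕ∞) fun y => φ y a := contDiff_pi.1 hφ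
  have hφd : ∀ z, DifferentiableAt ℝ φ z := fun z => hφ.differentiable (by simp) z
  set J : Matrix (Fin n) (Fin n) ℝ := jac φ x
  have hJK : J * J⁻¹ = 1 := Matrix.mul_nonsing_inv _ (hD x)
  have hKJ : J⁻¹ * J = 1 := Matrix.nonsing_inv_mul _ (hD x)
  set H : Fin n → Fin n → Fin n → ℝ :=
    fun a i j => pd (fun y => pd (fun z => φ z a) j y) i x
  have hHs : ∀ a i j, H a i j = H a j i := fun a i j => pd_pd_comm (hφa a) i j
  have hJd : ∀ a i, pd (fun y => φ y a) i x = J a i := fun _ _ => rfl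
  have hu1 : ∀ i y, pd u i y = ∑ a, pd (fun z => φ z a) i y * pd v a (φ y) := fun i y => by
    rw [huv]
    exact pd_comp (diff hvs _) (hφd y) i
  have hu2 : ∀ i j, pd (fun y => pd u j y) i x = (∑ a, H a i j * pd v a (φ x))
      + ∑ a, ∑ b, J a i * J b j * pd (fun y => pd v b y) a (φ x) := fun i j => by
    have hc : ∀ b, ContDiff ℝ (⊤ : ℕ∞) fun y => pd v b (φ y) :=
      fun b => (contDiff_pd hvs b).comp hφ
    simp only [hu1]
    rw [pd_sum _ fun b _ => (diff (contDiff_pd (hφa b) j) x).fun_mul (diff (hc b) x)]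
    simp only [pd_mul (diff (contDiff_pd (hφa _) j) x) (diff (hc _) x),
      Finset.sum_add_distrib]
    congr 1
    rw [Finset.sum_comm]
    refine Finset.sum_congr rfl fun b _ => ?_
    rw [pd_comp (diff (contDiff_pd hvs b) _) (hφd x) i, Finset.mul_sum]
    refine Finset.sum_congr rfl fun a _ => ?_
    simp only [hJd]
    ring
  have hT : ∀ a b k, ∑ c, J c k * pd (fun y => Sb a b y) c (φ x) = ∑ i, ∑ j,
      ((H a k i * J b j + J a i * H b k j) * S i j x
        + J a i * J b j * pd (fun y => S i j y) k x) := fun a b k => by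
    have h1 := pd_comp (x := x) (diff (hSb a b) _) (hφd x) k
    simp only [hJd] at h1
    rw [← h1]
    simp only [hStrans]
    have d1 : ∀ a i, DifferentiableAt ℝ (fun y => pd (fun z => φ z a) i y) x :=
      fun a i => diff (contDiff_pd (hφa a) i) x
    have d2 : ∀ i j, DifferentiableAt ℝ (fun y => pd (fun z => φ z a) i y *
        pd (fun z => φ z b) j y) x := fun i j => (d1 a i).fun_mul (d1 b j)
    have d3 := fun i j => (d2 i j).fun_mul (diff (hS i j) x)
    rw [pd_sum _ fun i _ => DifferentiableAt.fun_sum fun j _ => d3 i j]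
    refine Finset.sum_congr rfl fun i _ => ?_
    rw [pd_sum _ fun j _ => d3 i j]
    refine Finset.sum_congr rfl fun j _ => ?_
    rw [pd_mul (d2 i j) (diff (hS i j) x), pd_mul (d1 a i) (d1 b j)]
    rfl
  have hdiv := divergence_transform hKJ hHs (S := fun i j => S i j x)
    (dS := fun i j k => pd (fun y => S i j y) k x)
    (T := fun a b c => pd (fun y => Sb a b y) c (φ x)) hT
  have htr := trace_projective_transform hJK (H := H) (P := fun k i j => P k i j x)
    (Q := fun c a b => Pb c a b (φ x)) (S := fun i j => S i j x)
    (T := fun a b => Sb a b (φ x)) (fun i j => by rw [hSsym i j])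
    (1 / ((n : ℝ) + 1)) (fun k => pd (logJ φ) k x) (fun a b => hStrans a b x)
    (fun k i j => hPtrans k i j x)
  simp only [pd_logJ hφ (hD x)] at htr
  have hn1 : (n : ℝ) + 1 ≠ 0 := by positivity
  have hn3 : (n : ℝ) + 3 ≠ 0 := by positivity
  have hsec : ∑ i, ∑ j, S i j x * pd (fun y => pd u j y) i x
      = (∑ a, (∑ i, ∑ j, S i j x * H a i j) * pd v a (φ x))
        + ∑ a, ∑ b, Sb a b (φ x) * pd (fun y => pd v b y) a (φ x) := by
    simp only [hu2, mul_add, Finset.sum_add_distrib]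
    congr 1
    · simp only [Finset.mul_sum, Finset.sum_mul]
      rw [Finset.sum_comm_cycle]
      refine Finset.sum_congr rfl fun _ _ => Finset.sum_congr rfl fun _ _ =>
        Finset.sum_congr rfl fun _ _ => by ring
    · simp only [hStrans, hJd, Finset.mul_sum, Finset.sum_mul]
      simp only [← Finset.sum_product', Finset.univ_product_univ]
      refine Fintype.sum_equiv ⟨fun p => (p.2.2.1, p.2.2.2, p.1, p.2.1),
        fun p => (p.2.2.1, p.2.2.2, p.1, p.2.1), fun _ => rfl, fun _ => rfl⟩ _ _ fun p => ?_
      simp only [Equiv.coe_fn_mk]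
      ring
  have hfirst : ∀ B : Fin n → ℝ, ∑ i, B i * pd u i x
      = ∑ a, (∑ i, J a i * B i) * pd v a (φ x) := fun B => by
    simp only [hu1, hJd, Finset.mul_sum, Finset.sum_mul]
    rw [Finset.sum_comm]
    refine Finset.sum_congr rfl fun _ _ => Finset.sum_congr rfl fun _ _ => by ring
  simp only [projLap]
  rw [hsec, hfirst, add_comm (∑ a, _ * pd v a (φ x)), add_assoc]
  congr 1
  rw [← Finset.sum_add_distrib]
  refine Finset.sum_congr rfl fun a _ => ?_
  rw [← add_mul]
  congr 1
  simp only [mul_sub, Finset.sum_sub_distrib, mul_left_comm (J a _), ← Finset.mul_sum]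
  rw [htr a, hdiv a]
  field_simp
  ring
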